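/- For ε ∈ ℝ, the Choi matrix of Δ_ε, i.e. the 8×8 block matrix Ĉ_ε = [[Δ_ε(e₁₁), Δ_ε(e₁₂)], [Δ_ε(e₂₁), Δ_ε(e₂₂)]] where e_{ij} are the standard matrix units of M₂(ℂ), is positive semidefinite if and only if |ε| ≤ 1/(3√3). -/

import Mathlib

open Matrix Complex Kronecker ComplexOrder

/-- `M₂(ℂ)`. -/
abbrev M2 : Type := Matrix (Fin 2) (Fin 2) ℂ

/-- `M₂(ℂ) ⊗ M₂(ℂ)` identified with `M₄(ℂ)` via the Kronecker product. -/
abbrev M4 : Type := Matrix (Fin 2 × Fin 2) (Fin 2 × Fin 2) ℂ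

/-- The Pauli matrices `σ₁, σ₂, σ₃`. -/
noncomputable def Pauli : Fin 3 → M2 :=
  ![!![0, 1; 1, 0], !![0, -Complex.I; Complex.I, 0], !![1, 0; 0, -1]]

/-- `σ₁⊗σ₁ + σ₂⊗σ₃ + σ₃⊗σ₂`. -/
noncomputable def K1 : M4 := Pauli 0 ⊗ₖ Pauli 0 + Pauli 1 ⊗ₖ Pauli 2 + Pauli 2 ⊗ₖ Pauli 1

/-- `σ₁⊗σ₃ + σ₂⊗σ₂ + σ₃⊗σ₁`. -/
noncomputable def K2 : M4 := Pauli 0 ⊗ₖ Pauli 2 + Pauli 1 ⊗ₖ Pauli 1 + Pauli 2 ⊗ₖ Pauli 0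

/-- `σ₁⊗σ₂ + σ₂⊗σ₁ + σ₃⊗σ₃`. -/
noncomputable def K3 : M4 := Pauli 0 ⊗ₖ Pauli 1 + Pauli 1 ⊗ₖ Pauli 0 + Pauli 2 ⊗ₖ Pauli 2

/-- `Δ` is the map `Δ_ε`, i.e. on `x = w₀·1 + w·σ` it is given by
`Δ_ε(x) = w₀·(1⊗1) + ε[w₁ K1 + w₂ K2 + w₃ K3]`. -/
def IsDeltaEps (ε : ℝ) (Δ : M2 →ₗ[ℂ] M4) : Prop :=
  ∀ (w₀ : ℂ) (w : Fin 3 → ℂ),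
    Δ (w₀ • (1 : M2) + ∑ k, w k • Pauli k)
      = w₀ • (1 : M4) + (ε : ℂ) • (w 0 • K1 + w 1 • K2 + w 2 • K3)

/-- The traceless part of the Choi matrix: `2 Ĉ_ε = 1 + ε • choiTraceless`. -/
noncomputable def choiTraceless :
    Matrix (Fin 2 × Fin 2 ⊕ Fin 2 × Fin 2) (Fin 2 × Fin 2 ⊕ Fin 2 × Fin 2) ℂ :=
  fromBlocks K3 (K1 + I • K2) (K1 - I • K2) (-K3)

/-- With `choiVecB`, an orthogonal basis of the eigenspace of `choiTraceless ^ 2` for `27`. -/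
noncomputable def choiVecA : Fin 2 × Fin 2 ⊕ Fin 2 × Fin 2 → ℂ :=
  Sum.elim (fun p => !![0, -1 + I; -1 + I, 2] p.1 p.2)
    (fun p => !![-1 - I, 0; 0, 1 - I] p.1 p.2)

/-- With `choiVecA`, an orthogonal basis of the eigenspace of `choiTraceless ^ 2` for `27`. -/
noncomputable def choiVecB : Fin 2 × Fin 2 ⊕ Fin 2 × Fin 2 → ℂ :=
  Sum.elim (fun p => !![-I, 0; 0, 1] p.1 p.2) (fun p => !![1 + I, I; I, 0] p.1 p.2)

theorem IsDeltaEps.apply_eq {ε : ℝ} {Δ : M2 →ₗ[ℂ] M4} (hΔ : IsDeltaEps ε Δ) (x : M2) :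
    Δ x = ((x 0 0 + x 1 1) / 2) • (1 : M4) + (ε : ℂ) • (((x 0 1 + x 1 0) / 2) • K1
      + (I * (x 0 1 - x 1 0) / 2) • K2 + ((x 0 0 - x 1 1) / 2) • K3) := by
  have h := hΔ ((x 0 0 + x 1 1) / 2)
    ![(x 0 1 + x 1 0) / 2, I * (x 0 1 - x 1 0) / 2, (x 0 0 - x 1 1) / 2]
  simp only [Matrix.cons_val] at h
  rw [← h]
  congr 1
  ext i j
  fin_cases i <;> fin_cases j <;> simp [Fin.sum_univ_three, Pauli] <;> ring_nf <;>
    simp only [I_sq] <;> ring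

theorem IsDeltaEps.choi_eq {ε : ℝ} {Δ : M2 →ₗ[ℂ] M4} (hΔ : IsDeltaEps ε Δ) :
    fromBlocks (Δ (single 0 0 1)) (Δ (single 0 1 1)) (Δ (single 1 0 1)) (Δ (single 1 1 1))
      = (1 / 2 : ℝ) • (1 + ε • choiTraceless) := by
  rw [choiTraceless, ← fromBlocks_one, fromBlocks_smul, fromBlocks_add, fromBlocks_smul]
  simp only [hΔ.apply_eq]
  congr 1 <;> ext i j <;> simp <;> ring

theorem isHermitian_choiTraceless : choiTraceless.IsHermitian := by
  ext (⟨i, j⟩ | ⟨i, j⟩) (⟨k, l⟩ | ⟨k, l⟩) <;> fin_cases i <;> fin_cases j <;>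
    fin_cases k <;> fin_cases l <;>
    simp [choiTraceless, K1, K2, K3, Pauli, sub_eq_add_neg]

set_option maxHeartbeats 2000000 in
theorem choiTraceless_mul_self :
    choiTraceless * choiTraceless = (3 : ℝ) • 1 + (2 : ℝ) • vecMulVec choiVecA (star choiVecA)
      + (4 : ℝ) • vecMulVec choiVecB (star choiVecB) := by
  ext (⟨i, j⟩ | ⟨i, j⟩) (⟨k, l⟩ | ⟨k, l⟩) <;> fin_cases i <;> fin_cases j <;>
    fin_cases k <;> fin_cases l <;>
    simp [choiTraceless, K1, K2, K3, Pauli, mul_apply, Fintype.sum_prod_type, choiVecA,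
      choiVecB, vecMulVec_apply] <;> ring_nf <;> simp <;> ring_nf

theorem star_choiVecA_dotProduct_self : star choiVecA ⬝ᵥ choiVecA = 12 := by
  simp [dotProduct, map_ofNat, choiVecA, Fintype.sum_prod_type]
  ring_nf
  simp
  norm_num

theorem star_choiVecB_dotProduct_self : star choiVecB ⬝ᵥ choiVecB = 6 := by
  simp [dotProduct, choiVecB, Fintype.sum_prod_type]
  ring_nf
  simp
  norm_num

theorem star_choiVecA_dotProduct_choiVecB : star choiVecA ⬝ᵥ choiVecB = 0 := by
  simp [dotProduct, map_ofNat, choiVecA, choiVecB, Fintype.sum_prod_type]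
  ring_nf
  simp

theorem star_choiVecB_dotProduct_choiVecA : star choiVecB ⬝ᵥ choiVecA = 0 := by
  simp [dotProduct, choiVecA, choiVecB, Fintype.sum_prod_type]
  ring_nf
  simp

theorem choiTraceless_mulVec_choiVecA :
    choiTraceless *ᵥ choiVecA = 6 • choiVecB - 3 • choiVecA := by
  ext (⟨i, j⟩ | ⟨i, j⟩) <;> fin_cases i <;> fin_cases j <;>
    simp [mulVec, dotProduct, choiTraceless, K1, K2, K3, Pauli, Fintype.sum_prod_type, choiVecA,
      choiVecB] <;> ring_nf <;> simp <;> ring_nf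

theorem choiTraceless_mulVec_choiVecB :
    choiTraceless *ᵥ choiVecB = 3 • choiVecA + 3 • choiVecB := by
  ext (⟨i, j⟩ | ⟨i, j⟩) <;> fin_cases i <;> fin_cases j <;>
    simp [mulVec, dotProduct, choiTraceless, K1, K2, K3, Pauli, Fintype.sum_prod_type, choiVecA,
      choiVecB] <;> ring_nf <;> simp <;> ring_nf

theorem choiTraceless_mulVec_eigenvector {t : ℝ} (ht : t ^ 2 = 3) :
    choiTraceless *ᵥ (choiVecA + (1 + t) • choiVecB)
      = (3 * t) • (choiVecA + (1 + t) • choiVecB) := by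
  have ht' : (t : ℂ) ^ 2 = 3 := mod_cast ht
  rw [mulVec_add, mulVec_smul, choiTraceless_mulVec_choiVecA, choiTraceless_mulVec_choiVecB]
  ext i
  simp
  linear_combination -3 * choiVecB i * ht'

theorem posSemidef_sub_choiTraceless_mul_self :
    ((27 : ℝ) • 1 - choiTraceless * choiTraceless).PosSemidef := by
  set N := (27 : ℝ) • 1 - choiTraceless * choiTraceless with hN
  have hherm : Nᴴ = N := by
    simp [hN, isHermitian_choiTraceless.eq]
  have hsq : N = (1 / 24 : ℝ) • (Nᴴ * N) := by
    rw [hherm, hN, choiTraceless_mul_self]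
    simp only [mul_add, add_mul, mul_sub, sub_mul, smul_mul_assoc, mul_smul_comm,
      vecMulVec_mul_vecMulVec, star_choiVecA_dotProduct_self, star_choiVecB_dotProduct_self,
      star_choiVecA_dotProduct_choiVecB, star_choiVecB_dotProduct_choiVecA, one_mul, mul_one]
    ext i j
    simp [vecMulVec_apply]
    ring
  rw [hsq]
  exact (posSemidef_conjTranspose_mul_self N).smul (by norm_num)

theorem posSemidef_one_add_smul_choiTraceless {ε : ℝ} (hε : 27 * ε ^ 2 ≤ 1) :
    (1 + ε • choiTraceless).PosSemidef := by
  set B := 1 + ε • choiTraceless with hB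
  have hherm : Bᴴ = B := by
    simp [hB, isHermitian_choiTraceless.eq]
  have hdecomp : B = (1 / 2 : ℝ) • (Bᴴ * B) + ((1 - 27 * ε ^ 2) / 2) • 1
      + (ε ^ 2 / 2) • ((27 : ℝ) • 1 - choiTraceless * choiTraceless) := by
    rw [hherm, hB]
    simp only [mul_add, add_mul, smul_mul_assoc, mul_smul_comm, one_mul, mul_one]
    module
  rw [hdecomp]
  exact (((posSemidef_conjTranspose_mul_self B).smul (by norm_num)).add
    (PosSemidef.one.smul (by linarith))).add
    (posSemidef_sub_choiTraceless_mul_self.smul (by positivity))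

theorem nonneg_of_posSemidef_one_add_smul_choiTraceless {ε t : ℝ} (ht : t ^ 2 = 3)
    (h : (1 + ε • choiTraceless).PosSemidef) : 0 ≤ 1 + 3 * t * ε := by
  set y := choiVecA + (1 + t) • choiVecB with hy
  have hnorm : star y ⬝ᵥ y = ((12 + 6 * (1 + t) ^ 2 : ℝ) : ℂ) := by
    rw [hy]
    simp [star_choiVecA_dotProduct_self, star_choiVecB_dotProduct_self,
      star_choiVecA_dotProduct_choiVecB, star_choiVecB_dotProduct_choiVecA]
    ring
  have hquad := h.dotProduct_mulVec_nonneg y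
  have hBy : (1 + ε • choiTraceless) *ᵥ y = (1 + 3 * t * ε) • y := by
    rw [add_mulVec, one_mulVec, smul_mulVec, choiTraceless_mulVec_eigenvector ht]
    module
  rw [hBy, dotProduct_smul, hnorm, Complex.real_smul, ← Complex.ofReal_mul,
    Complex.zero_le_real] at hquad
  exact nonneg_of_mul_nonneg_left hquad (by positivity)

/-- The Choi matrix `[[Δ_ε(e₁₁), Δ_ε(e₁₂)], [Δ_ε(e₂₁), Δ_ε(e₂₂)]]` of `Δ_ε` is
positive semidefinite iff `|ε| ≤ 1/(3√3)`. -/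
theorem deltaEps_choi_psd_iff (ε : ℝ) (Δ : M2 →ₗ[ℂ] M4) (hΔ : IsDeltaEps ε Δ) :
    (Matrix.fromBlocks
        (Δ (Matrix.single 0 0 1)) (Δ (Matrix.single 0 1 1))
        (Δ (Matrix.single 1 0 1)) (Δ (Matrix.single 1 1 1))).PosSemidef
      ↔ |ε| ≤ 1 / (3 * Real.sqrt 3) := by
  have hsqrt : Real.sqrt 3 ^ 2 = 3 := Real.sq_sqrt (by norm_num)
  have hpos : 0 < Real.sqrt 3 := Real.sqrt_pos.mpr (by norm_num)
  rw [hΔ.choi_eq, le_div_iff₀ (by positivity)]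
  constructor
  · intro h
    have h' : (1 + ε • choiTraceless).PosSemidef := by
      simpa [smul_smul] using h.smul (show (0 : ℝ) ≤ 2 by norm_num)
    have h₁ := nonneg_of_posSemidef_one_add_smul_choiTraceless hsqrt h'
    have h₂ := nonneg_of_posSemidef_one_add_smul_choiTraceless
      (show (-Real.sqrt 3) ^ 2 = 3 by rw [neg_sq, hsqrt]) h'
    rcases abs_cases ε with ⟨h, -⟩ | ⟨h, -⟩ <;> rw [h] <;> linarith
  · intro h
    refine (posSemidef_one_add_smul_choiTraceless ?_).smul (by norm_num)
    calc 27 * ε ^ 2 = (|ε| * (3 * Real.sqrt 3)) ^ 2 := by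
          rw [mul_pow, mul_pow, hsqrt, sq_abs]; ring
      _ ≤ 1 := pow_le_one₀ (by positivity) h
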